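/- Let K ⊂ S^3 be a knot and p/q > 0 a rational number. For each i with 0 ≤ i ≤ p − 1, the map D^T_{i,p/q} : ⊕_{s∈Z} (s, A^T_{⌊(i+ps)/q⌋}) → ⊕_{s∈Z} (s, B^+), given by sending (s, a_s) to the element whose s-component is U^{V_{⌊(i+ps)/q⌋}}·a_s + U^{H_{⌊(i+p(s−1))/q⌋}}·a_{s−1} (each summand A^T_k and B^+ being a copy of the tower T^+ = F_2[U, U^{−1}]/U·F_2[U], with the first term mapping into the s-th B^+ summand and the second into the (s+1)-st), is surjective. -/

import Mathlib

/-- The tower `T⁺ = 𝔽₂[U, U⁻¹]/U·𝔽₂[U]`, realized as finitely supported functions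
`ℕ → 𝔽₂`:  the coordinate `n` records the coefficient of `U^{-n}`. -/
abbrev Tplus : Type := ℕ →₀ ZMod 2

/-- Multiplication by `U^v` on the tower `T⁺`: it shifts `U^{-n} ↦ U^{-(n-v)}`,
i.e. `(U^v · x) n = x (n + v)`. -/
noncomputable def Umul (v : ℕ) (x : Tplus) : Tplus :=
  Finsupp.comapDomain (· + v) x (fun a _ b _ h => by simpa using h)

/-- Abstract background for knots in `S³` and the invariants `V_k`, `H_k` from the
knot Floer complex:  the maps `v⁺_k, h⁺_k : A^T_k → B⁺` between towers are
multiplication by `U^{V_k}` and `U^{H_k}` respectively. -/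
structure KnotBackground where
  /-- knots `K ⊂ S³` -/
  Knot : Type
  /-- the nonnegative integer `V_k` -/
  V : Knot → ℤ → ℕ
  /-- the nonnegative integer `H_k` -/
  H : Knot → ℤ → ℕ
  /-- `sliceGenus K` is the four-ball (slice) genus `g*(K)` -/
  sliceGenus : Knot → ℕ
  /-- `V_k = H_{−k}` -/
  V_eq_H_neg : ∀ K (k : ℤ), V K k = H K (-k)
  /-- `V_k` is non-increasing in `k` -/
  V_antitone : ∀ K, Antitone (V K)
  /-- `V_k = 0` for `k ≥ g*(K)` -/
  V_eq_zero : ∀ K (k : ℤ), (sliceGenus K : ℤ) ≤ k → V K k = 0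
  /-- `H_k = 0` for `k ≤ −g*(K)` -/
  H_eq_zero : ∀ K (k : ℤ), k ≤ -(sliceGenus K : ℤ) → H K k = 0
  /-- `V_k → +∞` as `k → −∞` -/
  V_tendsto : ∀ K, Filter.Tendsto (V K) Filter.atBot Filter.atTop
  /-- `H_k → +∞` as `k → +∞` -/
  H_tendsto : ∀ K, Filter.Tendsto (H K) Filter.atTop Filter.atTop

theorem Umul_apply (v : ℕ) (x : Tplus) (n : ℕ) : Umul v x n = x (n + v) := by
  rfl

/-- A right inverse of `Umul v`. -/
noncomputable def Rinv (v : ℕ) (x : Tplus) : Tplus :=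
  Finsupp.mapDomain (· + v) x

theorem Umul_Rinv (v : ℕ) (x : Tplus) : Umul v (Rinv v x) = x := by
  ext n
  rw [Umul_apply, Rinv]
  exact Finsupp.mapDomain_apply (add_left_injective v) x n

theorem Umul_zero_left (x : Tplus) : Umul 0 x = x := by
  ext n
  simp [Umul_apply]

theorem Umul_zero_right (v : ℕ) : Umul v 0 = 0 := by
  ext n
  simp [Umul_apply]

theorem Rinv_zero_left (x : Tplus) : Rinv 0 x = x := by
  rw [← Umul_zero_left (Rinv 0 x), Umul_Rinv]

/-- The recursive solution. -/
noncomputable def solSeq (v h : ℕ → ℕ) (c : ℕ → Tplus) : ℕ → Tplus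
  | 0 => 0
  | n + 1 => Rinv (v n) (c n - Umul (h n) (solSeq v h c n))

theorem one_sided (v h : ℕ → ℕ) (c : ℕ → Tplus)
    (hv : ∃ N, ∀ n ≥ N, v n = 0) (hc : ∃ N, ∀ n ≥ N, c n = 0)
    (hh : ∀ M, ∃ N, ∀ n ≥ N, M ≤ h n) :
    ∃ a : ℕ → Tplus, a 0 = 0 ∧ (∃ N, ∀ n ≥ N, a n = 0) ∧
      ∀ n, c n = Umul (v n) (a (n + 1)) + Umul (h n) (a n) := by
  refine ⟨solSeq v h c, rfl, ?_, fun n => ?_⟩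
  · obtain ⟨N1, h1⟩ := hv
    obtain ⟨N2, h2⟩ := hc
    have step : ∀ n, N1 + N2 ≤ n → ∀ m, solSeq v h c (n + 1) m = - solSeq v h c n (m + h n) := by
      intro n hn m
      rw [solSeq, h1 n (by omega), h2 n (by omega), Rinv_zero_left, zero_sub, Finsupp.neg_apply,
        Umul_apply]
    obtain ⟨D, hD⟩ : ∃ D, ∀ m ≥ D, solSeq v h c (N1 + N2) m = 0 := by
      refine ⟨(solSeq v h c (N1 + N2)).support.sup id + 1, fun m hm => ?_⟩
      by_contra hne
      have := Finset.le_sup (f := id) (Finsupp.mem_support_iff.mpr hne)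
      simp only [id] at this
      omega
    have hD2 : ∀ n, N1 + N2 ≤ n → ∀ m ≥ D, solSeq v h c n m = 0 := by
      intro n hn
      induction n, hn using Nat.le_induction with
      | base => exact hD
      | succ n hn ih =>
        intro m hm
        rw [step n hn, ih _ (by omega), neg_zero]
    obtain ⟨N3, h3⟩ := hh D
    refine ⟨N1 + N2 + N3 + 1, fun n hn => ?_⟩
    obtain ⟨k, rfl⟩ : ∃ k, n = k + 1 := ⟨n - 1, by omega⟩
    ext m
    have := h3 k (by omega)
    rw [step k (by omega), hD2 k (by omega) _ (by omega)]
    simp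
  · rw [solSeq, Umul_Rinv]
    abel

theorem two_sided (V H : ℤ → ℕ)
    (hV0 : ∃ N : ℕ, ∀ s : ℤ, N ≤ s → V s = 0) (hH0 : ∃ N : ℕ, ∀ s : ℤ, s ≤ -N → H s = 0)
    (hV : ∀ M, ∃ N : ℕ, ∀ s : ℤ, s ≤ -N → M ≤ V s)
    (hH : ∀ M, ∃ N : ℕ, ∀ s : ℤ, N ≤ s → M ≤ H s) (b : ℤ →₀ Tplus) :
    ∃ a : ℤ →₀ Tplus, ∀ s : ℤ, b s = Umul (V s) (a s) + Umul (H (s - 1)) (a (s - 1)) := by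
  obtain ⟨Nb, hb⟩ : ∃ N : ℕ, ∀ s : ℤ, N ≤ s.natAbs → b s = 0 := by
    refine ⟨b.support.sup Int.natAbs + 1, fun m hm => ?_⟩
    by_contra hne
    have := Finset.le_sup (f := Int.natAbs) (Finsupp.mem_support_iff.mpr hne)
    omega
  obtain ⟨a1, h10, ⟨N1, h1z⟩, h1⟩ := one_sided (fun n => V (n + 1)) (fun n => H n)
    (fun n => b (n + 1))
    (by obtain ⟨N, h⟩ := hV0; exact ⟨N, fun n hn => h _ (by omega)⟩)
    ⟨Nb, fun n hn => hb _ (by omega)⟩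
    (by intro M; obtain ⟨N, h⟩ := hH M; exact ⟨N, fun n hn => h _ (by omega)⟩)
  obtain ⟨a2, h20, ⟨N2, h2z⟩, h2⟩ := one_sided (fun n => H (-n - 1)) (fun n => V (-n))
    (fun n => b (-n))
    (by obtain ⟨N, h⟩ := hH0; exact ⟨N, fun n hn => h _ (by omega)⟩)
    ⟨Nb, fun n hn => hb _ (by omega)⟩
    (by intro M; obtain ⟨N, h⟩ := hV M; exact ⟨N, fun n hn => h _ (by omega)⟩)
  let f : ℤ → Tplus := fun s => if 0 ≤ s then a1 s.toNat else a2 (-s).toNat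
  have f1 : ∀ n : ℕ, f n = a1 n := by intro n; simp [f]
  have f2 : ∀ n : ℕ, f (-n) = a2 n := by
    intro n
    rcases Nat.eq_zero_or_pos n with rfl | hn
    · simp [f, h10, h20]
    · have : ¬ (0 : ℤ) ≤ -n := by omega
      simp only [f, if_neg this, neg_neg, Int.toNat_natCast]
  have hfin : ∀ s, f s ≠ 0 → s ∈ Finset.Icc (-(N2 : ℤ)) N1 := by
    intro s hs
    rw [Finset.mem_Icc]
    by_contra hcon
    apply hs
    rcases le_total 0 s with h | h
    · obtain ⟨n, rfl⟩ := Int.eq_ofNat_of_zero_le h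
      rw [f1]; exact h1z n (by omega)
    · obtain ⟨n, hn⟩ := Int.eq_ofNat_of_zero_le (neg_nonneg.mpr h)
      obtain rfl : s = -n := by omega
      rw [f2]; exact h2z n (by omega)
  refine ⟨Finsupp.onFinset _ f hfin, fun s => ?_⟩
  simp only [Finsupp.onFinset_apply]
  rcases lt_or_ge 0 s with h | h
  · obtain ⟨n, hn⟩ := Int.eq_ofNat_of_zero_le (show 0 ≤ s - 1 by omega)
    obtain rfl : s = (n : ℤ) + 1 := by omega
    have e := f1 (n + 1)
    push_cast at e
    rw [add_sub_cancel_right, f1, e]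
    exact h1 n
  · obtain ⟨n, hn⟩ := Int.eq_ofNat_of_zero_le (neg_nonneg.mpr h)
    obtain rfl : s = -n := by omega
    have e := f2 (n + 1)
    push_cast at e
    rw [neg_add, ← sub_eq_add_neg] at e
    rw [f2, e, add_comm]
    exact h2 n

/-- Let `K ⊂ S³` be a knot and `p/q > 0` a rational number (with `p, q > 0`).  For
each `i` with `0 ≤ i ≤ p − 1`, the map
`D^T_{i,p/q} : ⊕_{s ∈ ℤ} (s, A^T_{⌊(i+ps)/q⌋}) → ⊕_{s ∈ ℤ} (s, B⁺)`,
sending `(s, a_s)` to the element whose `s`-component is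
`U^{V_{⌊(i+ps)/q⌋}}·a_s + U^{H_{⌊(i+p(s−1))/q⌋}}·a_{s−1}`
(each summand a copy of the tower `T⁺`), is surjective:  every finitely supported
family `b = (b_s)_{s ∈ ℤ}` has a finitely supported preimage `a = (a_s)_{s ∈ ℤ}`. -/
theorem DT_surjective (B : KnotBackground) (K : B.Knot) (p q : ℤ)
    (hp : 0 < p) (hq : 0 < q) (i : ℤ) (hi0 : 0 ≤ i) (hip : i ≤ p - 1) :
    ∀ b : ℤ →₀ Tplus, ∃ a : ℤ →₀ Tplus, ∀ s : ℤ,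
      b s = Umul (B.V K (Int.fdiv (i + p * s) q)) (a s)
            + Umul (B.H K (Int.fdiv (i + p * (s - 1)) q)) (a (s - 1)) := by
  intro b
  have up : ∀ M : ℤ, ∃ N : ℕ, ∀ s : ℤ, N ≤ s → M ≤ Int.fdiv (i + p * s) q := by
    intro M
    refine ⟨(M * q).natAbs, fun s hs => ?_⟩
    rw [Int.fdiv_eq_ediv_of_nonneg _ hq.le, Int.le_ediv_iff_mul_le hq]
    have h1 : M * q ≤ s := by omega
    have h2 : 0 ≤ s := by omega
    nlinarith
  have down : ∀ M : ℤ, ∃ N : ℕ, ∀ s : ℤ, s ≤ -N → Int.fdiv (i + p * s) q ≤ M := by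
    intro M
    refine ⟨(M * q).natAbs + 1, fun s hs => ?_⟩
    rw [Int.fdiv_eq_ediv_of_nonneg _ hq.le]
    apply le_of_lt
    rw [Int.ediv_lt_iff_lt_mul hq]
    rw [Nat.cast_add, Nat.cast_one] at hs
    have h1 : s + 1 ≤ M * q := by omega
    have h2 : s + 1 ≤ 0 := by omega
    nlinarith
  refine two_sided (fun s => B.V K (Int.fdiv (i + p * s) q))
    (fun s => B.H K (Int.fdiv (i + p * s) q)) ?_ ?_ ?_ ?_ b
  · obtain ⟨N, h⟩ := up (B.sliceGenus K)
    exact ⟨N, fun s hs => B.V_eq_zero K _ (h s hs)⟩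
  · obtain ⟨N, h⟩ := down (-(B.sliceGenus K))
    exact ⟨N, fun s hs => B.H_eq_zero K _ (h s hs)⟩
  · intro M
    obtain ⟨k, hk⟩ := Filter.eventually_atBot.mp ((B.V_tendsto K).eventually_ge_atTop M)
    obtain ⟨N, h⟩ := down k
    exact ⟨N, fun s hs => hk _ (h s hs)⟩
  · intro M
    obtain ⟨k, hk⟩ := Filter.eventually_atTop.mp ((B.H_tendsto K).eventually_ge_atTop M)
    obtain ⟨N, h⟩ := up k
    exact ⟨N, fun s hs => hk _ (h s hs)⟩
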